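/- Let T be the symmetric bilinear form on ℝ⁴ with T(e₃,e₃) = −1, T(e₄,e₄) = 1 and all other entries zero (the Ricci form of Petrov type D/O curvature with Φ₁₁ ≠ 0), and let R = A·(η∘η) + B·(η∘T) with A, B ∈ ℝ and B ≠ 0. Then the stabilizer g₀(R) equals the set of M ∈ so(1,3) that preserve both span(e₁,e₂) and span(e₃,e₄); it is 2-dimensional, spanned by the rotation J (Je₁ = e₂, Je₂ = −e₁, Je₃ = Je₄ = 0) and the boost K (Ke₃ = e₄, Ke₄ = e₃, Ke₁ = Ke₂ = 0). -/

import Mathlib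

/- STATEMENT 3. Work in ℝ⁴ with the Minkowski form η = diag(1,1,1,−1).  Let T
be the symmetric bilinear form with T(e₃,e₃) = −1, T(e₄,e₄) = 1 and all other
entries zero, and let R = A·(η∘η) + B·(η∘T) with B ≠ 0.  Then the stabilizer
g₀(R) equals the set of M ∈ so(1,3) preserving both span(e₁,e₂) and
span(e₃,e₄); it is 2-dimensional, spanned by the rotation J and the boost K. -/

open Matrix

noncomputable section

abbrev Mat4 := Matrix (Fin 4) (Fin 4) ℝ
abbrev Tensor4 := Fin 4 → Fin 4 → Fin 4 → Fin 4 → ℝ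

/-- The Minkowski form η = diag(1,1,1,−1). -/
def ηm : Mat4 := Matrix.diagonal ![1, 1, 1, -1]

/-- η as a (symmetric bilinear) array h_{ab}. -/
def ηf : Fin 4 → Fin 4 → ℝ := fun a b => ηm a b

/-- u♭, the covector η(u,·). -/
def flat (u : Fin 4 → ℝ) : Fin 4 → ℝ := ηm.mulVec u

/-- Membership in the Lorentz Lie algebra so(1,3): Mᵀη + ηM = 0. -/
def inSO13 (M : Mat4) : Prop := Mᵀ * ηm + ηm * M = 0

/-- Kulkarni–Nomizu product of two symmetric bilinear forms. -/
def kn (h k : Fin 4 → Fin 4 → ℝ) : Tensor4 := fun a b c d =>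
  h a c * k b d + h b d * k a c - h a d * k b c - h b c * k a d

/-- The action of so(1,3) on covariant 4-tensors:
    (M·R)_{abcd} = −Σ_e (Mᵉ_a R_{ebcd} + Mᵉ_b R_{aecd} + Mᵉ_c R_{abed} + Mᵉ_d R_{abce}). -/
def act (M : Mat4) (R : Tensor4) : Tensor4 := fun a b c d =>
  -(∑ e : Fin 4, (M e a * R e b c d + M e b * R a e c d
      + M e c * R a b e d + M e d * R a b c e))

/-- The stabilizer g₀(R) = {M ∈ so(1,3) : M·R = 0}. -/
def stab (R : Tensor4) : Set Mat4 := {M : Mat4 | inSO13 M ∧ act M R = 0}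

/-- The Ricci form T of Petrov type D/O curvature:
T(e₃,e₃) = −1, T(e₄,e₄) = 1, all other entries zero. -/
def Tform : Fin 4 → Fin 4 → ℝ := fun a b => Matrix.diagonal ![0, 0, -1, 1] a b

/-- R = A·(η∘η) + B·(η∘T). -/
def RtenD (A B : ℝ) : Tensor4 := fun a b c d =>
  A * kn ηf ηf a b c d + B * kn ηf Tform a b c d

/-- M preserves the subspace S: M maps S into itself. -/
def preserves (M : Mat4) (S : Submodule ℝ (Fin 4 → ℝ)) : Prop :=
  ∀ v ∈ S, M.mulVec v ∈ S

/-- The rotation J: Je₁ = e₂, Je₂ = −e₁, Je₃ = Je₄ = 0. -/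
def Jrot : Mat4 := !![0, -1, 0, 0; 1, 0, 0, 0; 0, 0, 0, 0; 0, 0, 0, 0]

/-- The boost K: Ke₃ = e₄, Ke₄ = e₃, Ke₁ = Ke₂ = 0. -/
def Kboost : Mat4 := !![0, 0, 0, 0; 0, 0, 0, 0; 0, 0, 0, 1; 0, 0, 1, 0]

/-- The action of an endomorphism on covariant 2-tensors. -/
def actForm (M : Mat4) (h : Fin 4 → Fin 4 → ℝ) : Fin 4 → Fin 4 → ℝ := fun a b =>
  -(∑ e : Fin 4, (M e a * h e b + M e b * h a e))

/-- Endomorphisms act on Kulkarni–Nomizu products as derivations. -/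
lemma act_kn (M : Mat4) (h k : Fin 4 → Fin 4 → ℝ) (a b c d : Fin 4) :
    act M (kn h k) a b c d = kn (actForm M h) k a b c d + kn h (actForm M k) a b c d := by
  simp only [act, kn, actForm, Fin.sum_univ_four]
  ring

lemma act_RtenD (M : Mat4) (A B : ℝ) (a b c d : Fin 4) :
    act M (RtenD A B) a b c d =
      A * act M (kn ηf ηf) a b c d + B * act M (kn ηf Tform) a b c d := by
  simp only [act, RtenD, Fin.sum_univ_four]
  ring

lemma actForm_ηf {M : Mat4} (hM : inSO13 M) : actForm M ηf = 0 := by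
  funext a b
  have h := congrFun (congrFun hM a) b
  simp only [Matrix.add_apply, Matrix.mul_apply, Matrix.transpose_apply, Matrix.zero_apply,
    Fin.sum_univ_four] at h
  simp only [actForm, ηf, Fin.sum_univ_four, Pi.zero_apply]
  linarith

lemma act_RtenD_of_inSO13 {M : Mat4} (hM : inSO13 M) (A B : ℝ) (a b c d : Fin 4) :
    act M (RtenD A B) a b c d = B * kn ηf (actForm M Tform) a b c d := by
  simp [act_RtenD, act_kn, actForm_ηf hM, kn]

lemma inSO13_iff (M : Mat4) :
    inSO13 M ↔ ∃ r₁ r₂ r₃ b₁ b₂ b₃ : ℝ,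
      M = !![0, -r₁, -r₂, b₁; r₁, 0, -r₃, b₂; r₂, r₃, 0, b₃; b₁, b₂, b₃, 0] := by
  constructor
  · intro hM
    have h (a b : Fin 4) := congrFun (congrFun hM a) b
    simp only [ηm, Matrix.add_apply, Matrix.mul_diagonal, Matrix.diagonal_mul,
      Matrix.transpose_apply, Matrix.zero_apply] at h
    refine ⟨M 1 0, M 2 0, M 2 1, M 3 0, M 3 1, M 3 2, ?_⟩
    ext i j
    have hij := h i j
    fin_cases i <;> fin_cases j <;> simp at hij ⊢ <;> linarith
  · rintro ⟨r₁, r₂, r₃, b₁, b₂, b₃, rfl⟩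
    unfold inSO13
    ext i j
    simp only [ηm, Matrix.add_apply, Matrix.mul_diagonal, Matrix.diagonal_mul,
      Matrix.transpose_apply, Matrix.zero_apply]
    fin_cases i <;> fin_cases j <;> simp

lemma mem_span_Jrot_Kboost_iff (M : Mat4) :
    M ∈ Submodule.span ℝ ({Jrot, Kboost} : Set Mat4) ↔
      ∃ r b : ℝ, M = !![0, -r, 0, 0; r, 0, 0, 0; 0, 0, 0, b; 0, 0, b, 0] := by
  rw [Submodule.mem_span_pair]
  have key (r b : ℝ) : r • Jrot + b • Kboost =
      !![0, -r, 0, 0; r, 0, 0, 0; 0, 0, 0, b; 0, 0, b, 0] := by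
    ext i j
    fin_cases i <;> fin_cases j <;> simp [Jrot, Kboost]
  simp only [key, eq_comm]

lemma mem_stab_RtenD_iff (A : ℝ) {B : ℝ} (hB : B ≠ 0) (M : Mat4) :
    M ∈ stab (RtenD A B) ↔ M ∈ Submodule.span ℝ ({Jrot, Kboost} : Set Mat4) := by
  rw [mem_span_Jrot_Kboost_iff]
  constructor
  · rintro ⟨hM, hR⟩
    have h (a b c d : Fin 4) : kn ηf (actForm M Tform) a b c d = 0 := by
      have := congrFun (congrFun (congrFun (congrFun hR a) b) c) d
      rw [act_RtenD_of_inSO13 hM] at this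
      exact (mul_eq_zero.mp this).resolve_left hB
    obtain ⟨r₁, r₂, r₃, b₁, b₂, b₃, rfl⟩ := (inSO13_iff M).mp hM
    have h₁ := h 0 1 2 1
    have h₂ := h 1 0 2 0
    have h₃ := h 0 1 3 1
    have h₄ := h 1 0 3 0
    simp [kn, actForm, ηf, ηm, Tform, Matrix.diagonal_apply] at h₁ h₂ h₃ h₄
    subst h₁ h₂ h₃ h₄
    exact ⟨r₁, b₃, by simp⟩
  · rintro ⟨r, b, rfl⟩
    have hM : inSO13 !![0, -r, 0, 0; r, 0, 0, 0; 0, 0, 0, b; 0, 0, b, 0] :=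
      (inSO13_iff _).mpr ⟨r, 0, 0, 0, 0, b, by simp⟩
    have hT : actForm !![0, -r, 0, 0; r, 0, 0, 0; 0, 0, 0, b; 0, 0, b, 0] Tform = 0 := by
      funext i j
      fin_cases i <;> fin_cases j <;>
        simp [actForm, Tform, Fin.sum_univ_four, Matrix.diagonal_apply]
    refine ⟨hM, ?_⟩
    funext i j k l
    simp [act_RtenD_of_inSO13 hM, hT, kn]

lemma mem_span_e₁_e₂_iff (v : Fin 4 → ℝ) :
    v ∈ Submodule.span ℝ ({![1,0,0,0], ![0,1,0,0]} : Set (Fin 4 → ℝ)) ↔ v 2 = 0 ∧ v 3 = 0 := by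
  rw [Submodule.mem_span_pair]
  constructor
  · rintro ⟨x, y, rfl⟩
    simp
  · rintro ⟨h₂, h₃⟩
    refine ⟨v 0, v 1, ?_⟩
    ext i
    fin_cases i <;> simp [h₂, h₃]

lemma mem_span_e₃_e₄_iff (v : Fin 4 → ℝ) :
    v ∈ Submodule.span ℝ ({![0,0,1,0], ![0,0,0,1]} : Set (Fin 4 → ℝ)) ↔ v 0 = 0 ∧ v 1 = 0 := by
  rw [Submodule.mem_span_pair]
  constructor
  · rintro ⟨x, y, rfl⟩
    simp
  · rintro ⟨h₀, h₁⟩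
    refine ⟨v 2, v 3, ?_⟩
    ext i
    fin_cases i <;> simp [h₀, h₁]

lemma inSO13_and_preserves_iff (M : Mat4) :
    (inSO13 M ∧
      preserves M (Submodule.span ℝ ({![1,0,0,0], ![0,1,0,0]} : Set (Fin 4 → ℝ))) ∧
      preserves M (Submodule.span ℝ ({![0,0,1,0], ![0,0,0,1]} : Set (Fin 4 → ℝ)))) ↔
      M ∈ Submodule.span ℝ ({Jrot, Kboost} : Set Mat4) := by
  rw [mem_span_Jrot_Kboost_iff]
  simp only [preserves, mem_span_e₁_e₂_iff, mem_span_e₃_e₄_iff]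
  constructor
  · rintro ⟨hM, h, -⟩
    obtain ⟨r₁, r₂, r₃, b₁, b₂, b₃, rfl⟩ := (inSO13_iff M).mp hM
    have h₁ := h ![1, 0, 0, 0] (by simp)
    have h₂ := h ![0, 1, 0, 0] (by simp)
    simp [Matrix.mulVec, dotProduct, Fin.sum_univ_four] at h₁ h₂
    obtain ⟨rfl, rfl⟩ := h₁
    obtain ⟨rfl, rfl⟩ := h₂
    exact ⟨r₁, b₃, by simp⟩
  · rintro ⟨r, b, rfl⟩
    refine ⟨(inSO13_iff _).mpr ⟨r, 0, 0, 0, 0, b, by simp⟩, ?_, ?_⟩ <;>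
    · rintro v ⟨hv, hv'⟩
      simp [Matrix.mulVec, dotProduct, Fin.sum_univ_four, hv, hv']

lemma linearIndependent_Jrot_Kboost : LinearIndependent ℝ ![Jrot, Kboost] := by
  rw [LinearIndependent.pair_iff]
  intro s t h
  have h₁ := congrFun (congrFun h 1) 0
  have h₂ := congrFun (congrFun h 2) 3
  simp [Jrot, Kboost] at h₁ h₂
  exact ⟨h₁, h₂⟩

/-- With R = A·(η∘η) + B·(η∘T), B ≠ 0: the stabilizer g₀(R) equals the set of
M ∈ so(1,3) that preserve both span(e₁,e₂) and span(e₃,e₄); it is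
2-dimensional, spanned by the rotation J and the boost K. -/
theorem stabilizer_type_D (A B : ℝ) (hB : B ≠ 0) :
    stab (RtenD A B) =
      {M : Mat4 | inSO13 M ∧
        preserves M (Submodule.span ℝ ({![1,0,0,0], ![0,1,0,0]} : Set (Fin 4 → ℝ))) ∧
        preserves M (Submodule.span ℝ ({![0,0,1,0], ![0,0,0,1]} : Set (Fin 4 → ℝ)))} ∧
    stab (RtenD A B) = ↑(Submodule.span ℝ ({Jrot, Kboost} : Set Mat4)) ∧
    Module.finrank ℝ ↥(Submodule.span ℝ ({Jrot, Kboost} : Set Mat4)) = 2 := by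
  refine ⟨?_, ?_, ?_⟩
  · ext M
    exact (mem_stab_RtenD_iff A hB M).trans (inSO13_and_preserves_iff M).symm
  · ext M
    exact mem_stab_RtenD_iff A hB M
  · rw [← Matrix.range_cons_cons_empty Jrot Kboost ![],
      finrank_span_eq_card linearIndependent_Jrot_Kboost, Fintype.card_fin]

end
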